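/- Define 𝒵₀(y,ν) := (1/2)(ν₁/ν₂)·B̄₂(y₁) + (1/2)(ν₂/ν₁)·B̄₂(y₂) + B̄₁(y₁)·B̄₁(y₂) − (1/4)·sgn(ν₂/ν₁)·1_ℤ(y₁)·1_ℤ(y₂) for y=(y₁,y₂) ∈ ℚ² and ν=(ν₁,ν₂) ∈ (ℝ∖{0})². Let γ=((a,b),(c,d)) be a 2×2 integer matrix with det γ ≠ 0 and c ≠ 0, let x=(x₁,x₂) ∈ ℚ², and let ω=(ω₁,ω₂) ∈ ℝ² have entries linearly independent over ℚ. Then 𝔷₀(γ)(x,ω) = sgn(c)·Σ_{m=0}^{|c|−1} 𝒵₀((x₁ − (x₂+m)·a/c, (x₂+m)/c), (ω₁, a·ω₁ + c·ω₂)). -/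

import Mathlib

open scoped Pointwise Classical
open MeasureTheory

/-- Periodic Bernoulli function `B̄₁`. -/
noncomputable def B1 (y : ℝ) : ℝ := if ∃ n : ℤ, (n : ℝ) = y then 0 else Int.fract y - 1 / 2

/-- Periodic Bernoulli function `B̄₂`. -/
noncomputable def B2 (y : ℝ) : ℝ := Int.fract y ^ 2 - Int.fract y + 1 / 6

/-- Dedekind–Rademacher sum `S(a,c;x)`. -/
noncomputable def DR (a c : ℤ) (x₁ x₂ : ℝ) : ℝ :=
  ∑ m ∈ Finset.range c.natAbs, B1 (x₁ + (x₂ + m) * a / c) * B1 ((x₂ + m) / c)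

/-- Indicator function of `ℤ ⊆ ℚ`. -/
def indZ (q : ℚ) : ℝ := if q.den = 1 then 1 else 0

/-- The cocycle `𝔷₀(γ)(x, ω)` for `γ` with entries `a, b, c, d` and `c ≠ 0`;
only `a` and `c` enter the formula. -/
noncomputable def Z0 (a c : ℤ) (x₁ x₂ : ℚ) (ω₁ ω₂ : ℝ) : ℝ :=
  (Int.gcd a c : ℝ) ^ 2 / (2 * c * ((a : ℝ) + c * (ω₂ / ω₁))) *
      B2 (((c : ℝ) / (Int.gcd a c : ℝ)) * (x₁ : ℝ) - ((a : ℝ) / (Int.gcd a c : ℝ)) * (x₂ : ℝ))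
    + ((a : ℝ) + c * (ω₂ / ω₁)) / (2 * c) * B2 (x₂ : ℝ)
    + Real.sign (c : ℝ) * DR (-a) c (x₁ : ℝ) (x₂ : ℝ)
    - Real.sign ((c : ℝ) * ((a : ℝ) + c * (ω₂ / ω₁))) / 4 * indZ x₁ * indZ x₂

/-- The closed triangle `T_γ` in `ℝ²` with vertices `(0,0)`, `(a−1,c)`, `(−1,0)`. -/
def Tri (a c : ℤ) : Set (ℝ × ℝ) :=
  convexHull ℝ {((0 : ℝ), (0 : ℝ)), (((a : ℝ) - 1), (c : ℝ)), ((-1 : ℝ), (0 : ℝ))}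

/-- Number of integral points in a subset of `ℝ²`. -/
noncomputable def latticeCount (S : Set (ℝ × ℝ)) : ℕ :=
  Set.ncard {p : ℤ × ℤ | ((p.1 : ℝ), (p.2 : ℝ)) ∈ S}

/-- The `0`th Ehrhart coefficient `G₀(ℓ⁻¹ T_σ, m)` of the dilated triangle `ℓ⁻¹ T_σ`,
obtained by subtracting the second and first Ehrhart coefficient terms from the
lattice point count of `(m/ℓ)·T_σ`. -/
noncomputable def G0 (aσ cσ : ℤ) (ℓσ ℓ : ℕ) (m : ℕ) : ℝ :=
  (latticeCount (((m : ℝ) / (ℓ : ℝ)) • Tri aσ cσ) : ℝ)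
    - (cσ : ℝ) / (2 * (ℓ : ℝ) ^ 2) * (m : ℝ) ^ 2
    - ((ℓσ : ℝ) + 2) / (2 * (ℓ : ℝ)) * (m : ℝ)


/-- The function `𝒵₀(y, ν)`. -/
noncomputable def Zcal0 (y₁ y₂ : ℚ) (ν₁ ν₂ : ℝ) : ℝ :=
  (1 / 2) * (ν₁ / ν₂) * B2 (y₁ : ℝ) + (1 / 2) * (ν₂ / ν₁) * B2 (y₂ : ℝ)
    + B1 (y₁ : ℝ) * B1 (y₂ : ℝ)
    - (1 / 4) * Real.sign (ν₂ / ν₁) * indZ y₁ * indZ y₂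


theorem B2_add_int (y : ℝ) (k : ℤ) : B2 (y + k) = B2 y := by
  unfold B2; rw [Int.fract_add_intCast]

theorem B2_neg (y : ℝ) : B2 (-y) = B2 y := by
  unfold B2
  by_cases h : Int.fract y = 0
  · rw [Int.fract_neg_eq_zero.2 h, h]
  · rw [Int.fract_neg h]; ring

theorem raabe_shift (n : ℕ) (hn : 0 < n) (y : ℝ) :
    ∑ m ∈ Finset.range n, B2 (y + 1 / n + m / n) = ∑ m ∈ Finset.range n, B2 (y + m / n) := by
  have h0 : (n : ℝ) ≠ 0 := by positivity
  have h1 := Finset.sum_range_succ (fun m : ℕ => B2 (y + m / n)) n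
  have h2 := Finset.sum_range_succ' (fun m : ℕ => B2 (y + m / n)) n
  have h3 : B2 (y + n / n) = B2 y := by
    rw [div_self h0]; simpa using B2_add_int y 1
  have h4 : ∀ m : ℕ, B2 (y + ((m + 1 : ℕ) : ℝ) / n) = B2 (y + 1 / n + m / n) := by
    intro m; congr 1; push_cast; ring
  simp only [h4] at h2
  simp only [Nat.cast_zero, zero_div, add_zero] at h2
  rw [h3] at h1
  linarith

theorem raabe_shift_int (n : ℕ) (hn : 0 < n) (y : ℝ) (k : ℤ) :
    ∑ m ∈ Finset.range n, B2 (y + k / n + m / n) = ∑ m ∈ Finset.range n, B2 (y + m / n) := by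
  induction k using Int.induction_on with
  | zero => simp
  | succ i ih =>
    rw [← ih, ← raabe_shift n hn (y + ((i : ℤ) : ℝ) / n)]
    refine Finset.sum_congr rfl fun m _ => ?_
    congr 1; push_cast; ring
  | pred i ih =>
    rw [← ih, ← raabe_shift n hn (y + ((-(i : ℤ) - 1 : ℤ) : ℝ) / n)]
    refine Finset.sum_congr rfl fun m _ => ?_
    congr 1; push_cast; ring

theorem sum_poly (n : ℕ) (r t : ℝ) :
    ∑ m ∈ Finset.range n, ((r + m * t) ^ 2 - (r + m * t) + 1 / 6)
      = n * (r ^ 2 - r + 1 / 6) + (2 * r * t - t) * (n * (n - 1) / 2)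
        + t ^ 2 * (n * (n - 1) * (2 * n - 1) / 6) := by
  induction n with
  | zero => simp
  | succ k ih => rw [Finset.sum_range_succ, ih]; push_cast; ring

theorem raabe (n : ℕ) (hn : 0 < n) (y : ℝ) :
    ∑ m ∈ Finset.range n, B2 (y + m / n) = B2 (n * y) / n := by
  have h0 : (0 : ℝ) < n := by positivity
  set r := Int.fract (n * y) / n with hr
  have hy : y = r + (⌊n * y⌋ : ℤ) / n := by
    rw [hr, ← add_div, Int.fract_add_floor]; field_simp
  have hr0 : 0 ≤ r := div_nonneg (Int.fract_nonneg _) h0.le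
  have hr1 : n * r < 1 := by
    rw [hr, mul_div_cancel₀ _ h0.ne']; exact Int.fract_lt_one _
  have hL : ∑ m ∈ Finset.range n, B2 (y + m / n) = ∑ m ∈ Finset.range n, B2 (r + m / n) := by
    rw [← raabe_shift_int n hn r ⌊n * y⌋, ← hy]
  have hR : B2 (n * y) = (n * r) ^ 2 - n * r + 1 / 6 := by
    unfold B2; rw [hr, mul_div_cancel₀ _ h0.ne']
  have hS : ∀ m ∈ Finset.range n, B2 (r + m / n)
      = (r + m * (1 / n : ℝ)) ^ 2 - (r + m * (1 / n : ℝ)) + 1 / 6 := by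
    intro m hm
    have hm' : (m : ℝ) + 1 ≤ n := by exact_mod_cast Finset.mem_range.1 hm
    have : Int.fract (r + m / n) = r + m * (1 / n : ℝ) := by
      rw [mul_one_div, Int.fract_eq_self]
      refine ⟨by positivity, ?_⟩
      have : r + m / n = (n * r + m) / n := by field_simp
      rw [this, div_lt_one h0]; linarith
    unfold B2; rw [this]
  rw [hL, hR, Finset.sum_congr rfl hS, sum_poly]
  field_simp
  ring

theorem sum_period_coprime (n : ℕ) (hn : 0 < n) (h : ℤ → ℝ) (hp : ∀ k j : ℤ, h (k + n * j) = h k)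
    (u : ℤ) (hu : IsCoprime u n) :
    ∑ m ∈ Finset.range n, h (m * u) = ∑ m ∈ Finset.range n, h m := by
  haveI : NeZero n := ⟨hn.ne'⟩
  have key : ∀ v : ℤ, h v = h ((v : ZMod n).val : ℤ) := by
    intro v
    rw [ZMod.val_intCast]
    conv_lhs => rw [← Int.emod_add_mul_ediv v n]
    rw [hp]
  have hs : ∀ f : ZMod n → ℝ, ∑ m ∈ Finset.range n, f (m : ZMod n) = ∑ z, f z := by
    intro f
    refine Finset.sum_bij (fun m _ => (m : ZMod n)) (by simp) ?_ ?_ (by simp)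
    · intro a ha b hb hab
      have := (ZMod.natCast_eq_natCast_iff' a b n).1 hab
      rwa [Nat.mod_eq_of_lt (Finset.mem_range.1 ha), Nat.mod_eq_of_lt (Finset.mem_range.1 hb)] at this
    · intro z _
      exact ⟨z.val, Finset.mem_range.2 (ZMod.val_lt z), by simp⟩
  have h1 := hs (fun z => h ((z * (u : ZMod n)).val : ℤ))
  have h2 := hs (fun z => h (z.val : ℤ))
  have hunit : IsUnit (u : ZMod n) := by
    obtain ⟨p, q, hpq⟩ := hu
    have : ((p * u + q * n : ℤ) : ZMod n) = 1 := by rw [hpq]; simp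
    push_cast at this
    rw [ZMod.natCast_self, mul_zero, add_zero] at this
    exact IsUnit.of_mul_eq_one_right _ this
  obtain ⟨w, hw⟩ := hunit
  have e := Equiv.sum_comp (Units.mulRight w) (fun z : ZMod n => h (z.val : ℤ))
  calc _ = ∑ m ∈ Finset.range n, h ((((m : ZMod n) * (u : ZMod n)).val : ℕ) : ℤ) :=
        Finset.sum_congr rfl fun m _ => by rw [key]; push_cast; rfl
    _ = _ := h1
    _ = ∑ z : ZMod n, h (z.val : ℤ) := by rw [← e]; simp [← hw]
    _ = _ := h2.symm
    _ = _ := Finset.sum_congr rfl fun m _ => by rw [key m]; push_cast; rfl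

theorem sum_period_mul (n g : ℕ) (h : ℤ → ℝ) (hp : ∀ k j : ℤ, h (k + n * j) = h k) :
    ∑ m ∈ Finset.range (g * n), h m = g * ∑ m ∈ Finset.range n, h m := by
  induction g with
  | zero => simp
  | succ k ih =>
    rw [Nat.succ_mul, Finset.sum_range_add, ih]
    have : ∀ m : ℕ, h ((k * n + m : ℕ) : ℤ) = h m := by
      intro m; rw [← hp m k]; congr 1; push_cast; ring
    simp only [this]; push_cast; ring

theorem indZ_int (k : ℤ) : indZ (k : ℚ) = 1 := by simp [indZ]

theorem indZ_ne {q : ℚ} (h : ∀ k : ℤ, q ≠ k) : indZ q = 0 := by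
  unfold indZ
  rw [if_neg]
  intro hq
  exact h q.num ((Rat.den_eq_one_iff q).1 hq).symm

theorem indZ_sub_int (q : ℚ) (k : ℤ) : indZ (q - k) = indZ q := by
  by_cases h : ∃ j : ℤ, q = j
  · obtain ⟨j, rfl⟩ := h
    rw [indZ_int, ← Int.cast_sub, indZ_int]
  · push Not at h
    rw [indZ_ne h, indZ_ne]
    intro j hj
    exact h (j + k) (by push_cast; linarith)

theorem term4 (a c : ℤ) (hc : c ≠ 0) (x₁ x₂ : ℚ) :
    ∑ m ∈ Finset.range c.natAbs, indZ (x₁ - (x₂ + (m : ℚ)) * (a : ℚ) / (c : ℚ)) *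
      indZ ((x₂ + (m : ℚ)) / (c : ℚ)) = indZ x₁ * indZ x₂ := by
  have hcq : (c : ℚ) ≠ 0 := by exact_mod_cast hc
  by_cases h : ∃ j : ℤ, x₂ = j
  · obtain ⟨k, rfl⟩ := h
    have hnn : 0 ≤ (-k) % c := Int.emod_nonneg _ hc
    obtain ⟨m0, hm0⟩ := Int.eq_ofNat_of_zero_le hnn
    have hlt : m0 < c.natAbs := by
      have := Int.emod_lt_abs (-k) hc
      rw [Int.abs_eq_natAbs] at this
      omega
    have hdvd : c ∣ k + m0 := by
      have := Int.emod_add_mul_ediv (-k) c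
      exact ⟨-(-k / c), by rw [← hm0]; linarith⟩
    rw [Finset.sum_eq_single m0]
    · obtain ⟨q, hq⟩ := hdvd
      have hq' : (k : ℚ) + m0 = c * q := by exact_mod_cast hq
      rw [hq', mul_div_cancel_left₀ _ hcq, indZ_int, indZ_int]
      have : (c : ℚ) * q * a / c = ((q * a : ℤ) : ℚ) := by push_cast; field_simp
      rw [this, indZ_sub_int]
    · intro m hm hne
      rw [indZ_ne (q := ((k : ℚ) + m) / c), mul_zero]
      intro j hj
      rw [div_eq_iff hcq] at hj
      have hj' : k + m = j * c := by exact_mod_cast hj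
      have hd : c ∣ (m : ℤ) - m0 := by
        have := dvd_sub (Dvd.intro_left j hj'.symm) hdvd
        simpa using this
      have hm' := Finset.mem_range.1 hm
      have := Int.eq_zero_of_abs_lt_dvd ((abs_dvd c _).2 hd) (by rw [abs_lt, Int.abs_eq_natAbs]; omega)
      omega
    · intro hm; exact absurd (Finset.mem_range.2 hlt) hm
  · push Not at h
    rw [indZ_ne h, mul_zero]
    refine Finset.sum_eq_zero fun m _ => ?_
    rw [indZ_ne (q := (x₂ + m) / c), mul_zero]
    intro j hj
    rw [div_eq_iff hcq] at hj
    exact h (j * c - m) (by push_cast; linarith)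

theorem sign_cases (c : ℤ) (hc : c ≠ 0) :
    ∃ s : ℤ, (s = 1 ∨ s = -1) ∧ c = s * c.natAbs ∧ Real.sign (c : ℝ) = s := by
  rcases lt_or_gt_of_ne hc with h | h
  · refine ⟨-1, Or.inr rfl, by omega, ?_⟩
    rw [Real.sign_of_neg (by exact_mod_cast h)]; simp
  · refine ⟨1, Or.inl rfl, by omega, ?_⟩
    rw [Real.sign_of_pos (by exact_mod_cast h)]; simp

theorem term2 (c : ℤ) (hc : c ≠ 0) (x : ℝ) :
    Real.sign (c : ℝ) * ∑ m ∈ Finset.range c.natAbs, B2 ((x + m) / c) = B2 x / c := by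
  obtain ⟨s, hs, hcs, hsg⟩ := sign_cases c hc
  have hn : 0 < c.natAbs := Int.natAbs_pos.2 hc
  set n := c.natAbs
  have hn0 : (n : ℝ) ≠ 0 := by positivity
  have hcr : (c : ℝ) = s * n := by exact_mod_cast hcs
  have h1 : ∀ m : ℕ, B2 ((x + m) / c) = B2 (x / n + m / n) := by
    intro m
    rw [hcr]
    rcases hs with rfl | rfl
    · congr 1; push_cast; ring
    · rw [← B2_neg]; congr 1; push_cast; field_simp
  simp only [h1]
  rw [raabe n hn, hsg, mul_div_cancel₀ _ hn0, hcr]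
  rcases hs with rfl | rfl <;> push_cast <;> field_simp

theorem term1 (a c : ℤ) (hc : c ≠ 0) (x₁ x₂ : ℝ) :
    Real.sign (c : ℝ) * ∑ m ∈ Finset.range c.natAbs, B2 (x₁ - (x₂ + m) * a / c)
      = (Int.gcd a c : ℝ) ^ 2 / c *
        B2 (((c : ℝ) / (Int.gcd a c : ℝ)) * x₁ - ((a : ℝ) / (Int.gcd a c : ℝ)) * x₂) := by
  obtain ⟨s, hs, hcs, hsg⟩ := sign_cases c hc
  have hg : 0 < Int.gcd a c := Int.gcd_pos_of_ne_zero_right a hc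
  obtain ⟨a', c', hcop, ha, hc'⟩ := Int.exists_gcd_one hg
  generalize Int.gcd a c = g at *
  have hg0 : (g : ℝ) ≠ 0 := by positivity
  have hc0' : c' ≠ 0 := by rintro rfl; simp at hc'; exact hc hc'
  have hn : 0 < c'.natAbs := Int.natAbs_pos.2 hc0'
  have hN : c.natAbs = g * c'.natAbs := by rw [hc', Int.natAbs_mul]; simp [mul_comm]
  have hcs' : c' = s * c'.natAbs := by
    rw [hN] at hcs
    have : (g : ℤ) * c' = g * (s * c'.natAbs) := by push_cast at hcs ⊢; linarith
    exact mul_left_cancel₀ (by exact_mod_cast hg.ne') this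
  have hcop' : IsCoprime (-s * a') (c'.natAbs : ℤ) := by
    have h0 : IsCoprime a' (c'.natAbs : ℤ) := by
      rw [Int.isCoprime_iff_gcd_eq_one]; rw [← hcop]; simp only [Int.gcd, Int.natAbs_natCast]
    rcases hs with rfl | rfl
    · simpa using h0.neg_left
    · simpa using h0
  rw [hN]
  set n := c'.natAbs
  have hn0 : (n : ℝ) ≠ 0 := by positivity
  have hcr : (c : ℝ) = s * n * g := by rw [hc', hcs']; push_cast; ring
  have har : (a : ℝ) = a' * g := by rw [ha]; push_cast; ring
  have hs2 : (s : ℝ) * s = 1 := by rcases hs with rfl | rfl <;> norm_num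
  have hs0 : (s : ℝ) ≠ 0 := left_ne_zero_of_mul_eq_one hs2
  set y : ℝ := x₁ - x₂ * a / c with hy
  let H : ℤ → ℝ := fun k => B2 (y + k / n)
  have hH : ∀ k j : ℤ, H (k + n * j) = H k := by
    intro k j
    simp only [H]
    rw [← B2_add_int (y + k / n) j]; congr 1; push_cast; field_simp; ring
  have h1 : ∀ m : ℕ, B2 (x₁ - (x₂ + m) * a / c) = H (m * (-s * a')) := by
    intro m
    simp only [H, hy]
    congr 1
    rw [hcr, har]; push_cast
    rcases hs with rfl | rfl <;> push_cast <;> field_simp <;> ring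
  simp only [h1]
  have e1 := sum_period_mul n g (fun k => H (k * (-s * a'))) (by
    intro k j
    beta_reduce
    rw [← hH (k * (-s * a')) (j * (-s * a'))]; congr 1; ring)
  have e2 := sum_period_coprime n hn H hH (-s * a') hcop'
  have e3 : ∑ m ∈ Finset.range n, H m = B2 (n * y) / n := by
    rw [← raabe n hn]; simp [H]
  rw [e1, e2, e3, hsg]
  have e4 : B2 ((c : ℝ) / g * x₁ - a / g * x₂) = B2 (n * y) := by
    rw [hy, hcr, har]
    rcases hs with rfl | rfl
    · congr 1; push_cast; field_simp
    · rw [← B2_neg]; congr 1; push_cast; field_simp; ring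
  rw [e4, hcr]
  rcases hs with rfl | rfl <;> push_cast <;> field_simp

theorem sign_mul' (x y : ℝ) : Real.sign (x * y) = Real.sign x * Real.sign y := by
  rcases lt_trichotomy x 0 with hx | rfl | hx <;> rcases lt_trichotomy y 0 with hy | rfl | hy <;>
    simp [Real.sign_of_neg, Real.sign_of_pos, mul_pos_of_neg_of_neg, mul_neg_of_neg_of_pos,
      mul_neg_of_pos_of_neg, *]

/-- **Theorem (Statement 19).** `𝔷₀(γ)` as the action of `((1,a),(0,c))` on `𝒵₀`. -/
theorem statement19 (a b c d : ℤ) (hdet : a * d - b * c ≠ 0) (hc : c ≠ 0)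
    (x₁ x₂ : ℚ) (ω₁ ω₂ : ℝ) (hω : LinearIndependent ℚ ![ω₁, ω₂]) :
    Z0 a c x₁ x₂ ω₁ ω₂
      = Real.sign (c : ℝ) * ∑ m ∈ Finset.range c.natAbs,
          Zcal0 (x₁ - (x₂ + (m : ℚ)) * (a : ℚ) / (c : ℚ)) ((x₂ + (m : ℚ)) / (c : ℚ))
            ω₁ ((a : ℝ) * ω₁ + (c : ℝ) * ω₂) := by
  have hω0 : ω₁ ≠ 0 := by simpa using hω.ne_zero 0
  have hv : (a : ℝ) * ω₁ + c * ω₂ = (a + c * (ω₂ / ω₁)) * ω₁ := by field_simp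
  unfold Z0 Zcal0 DR
  rw [hv]
  generalize (a : ℝ) + c * (ω₂ / ω₁) = T
  have r1 : T * ω₁ / ω₁ = T := by field_simp
  have r2 : ω₁ / (T * ω₁) = T⁻¹ := by rw [mul_comm, div_mul_cancel_left₀ hω0]
  have t1 := term1 a c hc x₁ x₂
  have t2 := term2 c hc x₂
  have t4 := term4 a c hc x₁ x₂
  have t3 : ∀ m : ℕ, (x₁ : ℝ) + (x₂ + m) * ((-a : ℤ) : ℝ) / c = x₁ - (x₂ + m) * a / c := by
    intro m; push_cast; ring
  rw [r1, r2, sign_mul']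
  simp only [t3]
  push_cast
  have r4 : ∀ p q : ℚ, 1 / 4 * T.sign * indZ p * indZ q = 1 / 4 * T.sign * (indZ p * indZ q) :=
    fun p q => by ring
  simp only [r4]
  rw [Finset.sum_sub_distrib, Finset.sum_add_distrib, Finset.sum_add_distrib,
    ← Finset.mul_sum, ← Finset.mul_sum, ← Finset.mul_sum, t4]
  have f1 : (Int.gcd a c : ℝ) ^ 2 / (2 * c * T) *
      B2 (((c : ℝ) / (Int.gcd a c : ℝ)) * (x₁ : ℝ) - ((a : ℝ) / (Int.gcd a c : ℝ)) * (x₂ : ℝ))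
      = 1 / 2 * T⁻¹ * ((Int.gcd a c : ℝ) ^ 2 / c *
      B2 (((c : ℝ) / (Int.gcd a c : ℝ)) * (x₁ : ℝ) - ((a : ℝ) / (Int.gcd a c : ℝ)) * (x₂ : ℝ))) := by
    simp only [div_eq_mul_inv, mul_inv]; ring
  have f2 : T / (2 * c) * B2 (x₂ : ℝ) = 1 / 2 * T * (B2 (x₂ : ℝ) / c) := by
    simp only [div_eq_mul_inv, mul_inv]; ring
  rw [f1, f2, ← t1, ← t2]
  ring
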